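/- arXiv:2208.09301 — 3 statements merged into one kernel-verified Lean document; each statement's English description precedes it below -/
import Mathlib

section
/- Fix n ≥ 1, let Σ := ⋀•(ℂ^{2n−1}) be the exterior algebra on generators y₁, …, y_{2n−1}, with Clifford multiplication operators c₁ := i·Id on even / −i·Id on odd degrees, c_{2j} := i(x_j⌟ + y_j∧), c_{2j+1} := y_j∧ − x_j⌟ (1 ≤ j ≤ 2n−1), and let ω := Σ_{p=1}^{n−1} y_{2p}∧y_{2p+1}. Then for every integer k ≥ 0: (1) Σ_{p=1}^{n−1} ( c_{4p}∘c_{4p+1} − c_{4p+2}∘c_{4p+3} )(ω^k) = 0; and (2) −Σ_{p=1}^{n−1} ( c_{4p}∘c_{4p+1} + c_{4p+2}∘c_{4p+3} )(ω^k) = 2i(2k − n + 1)·ω^k. (These are the Clifford products Φ₀·ω^k = 0 and (Φ₁|_H)·ω^k = 2i(2k−n+1)ω^k of the invariant two-forms Φ₀ and Φ₁ restricted to the horizontal distribution, computed in an adapted frame of a (4n−1)-dimensional homogeneous 3-Sasakian space.) -/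
noncomputable section

/-- The underlying `(2n-1)`-dimensional complex vector space `ℂ^{2n-1}`. -/
abbrev ModelV (n : ℕ) : Type := Fin (2 * n - 1) → ℂ

/-- The exterior-form model `Σ = ⋀•(ℂ^{2n-1})` of the spinor module. -/
abbrev SpinorModel (n : ℕ) : Type := ExteriorAlgebra ℂ (ModelV n)

/-- The generator `y_{j+1}` (so `j` is the 0-based index), with junk value `0` out of range. -/
def yGen (n j : ℕ) : SpinorModel n :=
  if h : j < 2 * n - 1 then
    ExteriorAlgebra.ι ℂ (Pi.single (⟨j, h⟩ : Fin (2 * n - 1)) (1 : ℂ))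
  else 0

/-- Left exterior multiplication `y_{j+1} ∧ ·` (0-based index `j`). -/
def wdg (n j : ℕ) : SpinorModel n →ₗ[ℂ] SpinorModel n :=
  LinearMap.mulLeft ℂ (yGen n j)

/-- Contraction `x_{j+1} ⌟ ·` with the `(j+1)`-st dual basis vector (0-based index `j`),
with junk value `0` out of range. -/
def ctr (n j : ℕ) : SpinorModel n →ₗ[ℂ] SpinorModel n :=
  if h : j < 2 * n - 1 then
    CliffordAlgebra.contractLeft (LinearMap.proj (⟨j, h⟩ : Fin (2 * n - 1)))
  else 0

/-- The Clifford multiplication operators `c_a`, `1 ≤ a ≤ 4n-1`, of the exterior-form model: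
`c₁ = i·Id` on even degrees and `-i·Id` on odd degrees, `c_{2j} = i(x_j⌟ + y_j∧)` and
`c_{2j+1} = y_j∧ - x_j⌟` for `1 ≤ j ≤ 2n-1` (1-based indices). -/
def cop (n a : ℕ) : SpinorModel n →ₗ[ℂ] SpinorModel n :=
  if a = 1 then
    Complex.I • (CliffordAlgebra.involute : SpinorModel n →ₐ[ℂ] SpinorModel n).toLinearMap
  else if a % 2 = 0 then Complex.I • (ctr n (a / 2 - 1) + wdg n (a / 2 - 1))
  else wdg n (a / 2 - 1) - ctr n (a / 2 - 1)

/-- The invariant `2`-form `ω = ∑_{p=1}^{n-1} y_{2p} ∧ y_{2p+1}`. -/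
def om (n : ℕ) : SpinorModel n :=
  ∑ p ∈ Finset.Icc 1 (n - 1), yGen n (2 * p - 1) * yGen n (2 * p)

/-- The invariant Killing spinors `ψ_k = ω^{k+1} - i(k+1)·y₁∧ω^k`, reindexed by
`j = k + 1` (so `psi n j` is `ψ_{j-1}`, and `psi n 0 = ψ_{-1} = 1`). -/
def psi (n j : ℕ) : SpinorModel n :=
  om n ^ j - (Complex.I * (j : ℂ)) • (yGen n 0 * om n ^ (j - 1))

/-- The space of invariant spinors `Σ_inv = span_ℂ{ω^k, y₁∧ω^k : 0 ≤ k ≤ n-1}`. -/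
def Sinv (n : ℕ) : Submodule ℂ (SpinorModel n) :=
  Submodule.span ℂ {x | ∃ k ≤ n - 1, x = om n ^ k ∨ x = yGen n 0 * om n ^ k}

/-- The space of invariant Killing spinors `K = span_ℂ{ψ_k : -1 ≤ k ≤ n-1}`. -/
def KSpan (n : ℕ) : Submodule ℂ (SpinorModel n) :=
  Submodule.span ℂ {x | ∃ j ≤ n, x = psi n j}

theorem yGen_mul_self (n j : ℕ) : yGen n j * yGen n j = 0 := by
  unfold yGen
  split_ifs
  · exact ExteriorAlgebra.ι_sq_zero _
  · simp

theorem yGen_mul_yGen_swap (n i j : ℕ) : yGen n i * yGen n j = -(yGen n j * yGen n i) := by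
  unfold yGen
  split_ifs
  · exact eq_neg_of_add_eq_zero_left (ExteriorAlgebra.ι_add_mul_swap _ _)
  all_goals simp

theorem commute_om_yGen (n j : ℕ) : Commute (om n) (yGen n j) := by
  refine Commute.sum_left _ _ _ fun p _ => ?_
  rw [Commute, SemiconjBy, mul_assoc, yGen_mul_yGen_swap n (2 * p) j, mul_neg, ← mul_assoc,
    yGen_mul_yGen_swap n (2 * p - 1) j, neg_mul, neg_neg, mul_assoc]

theorem ctr_yGen_mul {n i j : ℕ} (hi : i < 2 * n - 1) (hj : j < 2 * n - 1)
    (z : SpinorModel n) :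
    ctr n j (yGen n i * z) = (if j = i then z else 0) - yGen n i * ctr n j z := by
  simp only [ctr, yGen, dif_pos hi, dif_pos hj]
  refine (CliffordAlgebra.contractLeft_ι_mul _ _ _).trans ?_
  congr 1
  simp [Pi.single_apply, ite_smul]

theorem ctr_ctr (n j : ℕ) (z : SpinorModel n) : ctr n j (ctr n j z) = 0 := by
  unfold ctr
  split_ifs
  · apply CliffordAlgebra.contractLeft_contractLeft
  · simp

theorem ctr_one (n j : ℕ) : ctr n j 1 = 0 := by
  unfold ctr
  split_ifs
  · apply CliffordAlgebra.contractLeft_one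
  · simp

theorem cop_comp_cop {n j : ℕ} (hj : j < 2 * n - 1) (z : SpinorModel n) :
    cop n (2 * (j + 1)) (cop n (2 * (j + 1) + 1) z) =
      Complex.I • (z - (2 : ℂ) • (yGen n j * ctr n j z)) := by
  have h₁ : 2 * (j + 1) / 2 - 1 = j := by omega
  have h₂ : (2 * (j + 1) + 1) / 2 - 1 = j := by omega
  have h₃ : (2 * (j + 1) + 1) % 2 ≠ 0 := by omega
  have h₄ : 2 * (j + 1) ≠ 1 := by omega
  have h₅ : 2 * (j + 1) + 1 ≠ 1 := by omega
  have h₆ : yGen n j * (yGen n j * z) = 0 := by rw [← mul_assoc, yGen_mul_self, zero_mul]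
  simp only [cop, if_neg h₄, if_neg h₅, if_neg h₃, Nat.mul_mod_right, if_true, h₁, h₂]
  simp only [LinearMap.smul_apply, LinearMap.add_apply, LinearMap.sub_apply, map_sub, wdg,
    LinearMap.mulLeft_apply, ctr_yGen_mul hj hj, ctr_ctr, h₆, if_true]
  module

theorem ctr_om_mul {n j : ℕ} (hj : j < 2 * n - 1) (z : SpinorModel n) :
    ctr n j (om n * z) =
      (∑ p ∈ Finset.Icc 1 (n - 1),
        ((if j = 2 * p - 1 then yGen n (2 * p) * z else 0) -
          if j = 2 * p then yGen n (2 * p - 1) * z else 0)) + om n * ctr n j z := by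
  simp only [om, Finset.sum_mul, map_sum, ← Finset.sum_add_distrib]
  refine Finset.sum_congr rfl fun p hp => ?_
  rw [Finset.mem_Icc] at hp
  rw [mul_assoc, ctr_yGen_mul (by omega) hj, ctr_yGen_mul (by omega) hj, mul_sub, mul_ite,
    mul_zero, mul_assoc]
  abel

theorem ctr_odd_om_mul {n p : ℕ} (hp : p ∈ Finset.Icc 1 (n - 1)) (z : SpinorModel n) :
    ctr n (2 * p - 1) (om n * z) = yGen n (2 * p) * z + om n * ctr n (2 * p - 1) z := by
  have hp' := Finset.mem_Icc.mp hp
  rw [ctr_om_mul (by omega), Finset.sum_eq_single_of_mem p hp, if_pos rfl, if_neg (by omega),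
    sub_zero]
  intro q hq hqp
  rw [Finset.mem_Icc] at hq
  rw [if_neg (by omega), if_neg (by omega), sub_zero]

theorem ctr_even_om_mul {n p : ℕ} (hp : p ∈ Finset.Icc 1 (n - 1)) (z : SpinorModel n) :
    ctr n (2 * p) (om n * z) = -yGen n (2 * p - 1) * z + om n * ctr n (2 * p) z := by
  have hp' := Finset.mem_Icc.mp hp
  rw [ctr_om_mul (by omega), Finset.sum_eq_single_of_mem p hp, if_pos rfl, if_neg (by omega),
    zero_sub, neg_mul]
  intro q hq hqp
  rw [Finset.mem_Icc] at hq
  rw [if_neg (by omega), if_neg (by omega), sub_zero]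

theorem ctr_om_pow {n j : ℕ} {v : SpinorModel n} (hv : Commute (om n) v)
    (h : ∀ z, ctr n j (om n * z) = v * z + om n * ctr n j z) (k : ℕ) :
    ctr n j (om n ^ k) = (k : ℂ) • (v * om n ^ (k - 1)) := by
  induction k with
  | zero => simp [ctr_one]
  | succ k ih =>
    rw [pow_succ', h, ih, mul_smul_comm, ← mul_assoc, hv.eq, mul_assoc, Nat.add_sub_cancel]
    rcases k with _ | k
    · simp
    · rw [Nat.add_sub_cancel, ← pow_succ']
      push_cast
      module

theorem yGen_mul_ctr_odd_om_pow {n p : ℕ} (hp : p ∈ Finset.Icc 1 (n - 1)) (k : ℕ) :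
    yGen n (2 * p - 1) * ctr n (2 * p - 1) (om n ^ k) =
      (k : ℂ) • (yGen n (2 * p - 1) * yGen n (2 * p) * om n ^ (k - 1)) := by
  rw [ctr_om_pow (commute_om_yGen _ _) (ctr_odd_om_mul hp), mul_smul_comm, mul_assoc]

theorem yGen_mul_ctr_even_om_pow {n p : ℕ} (hp : p ∈ Finset.Icc 1 (n - 1)) (k : ℕ) :
    yGen n (2 * p) * ctr n (2 * p) (om n ^ k) =
      (k : ℂ) • (yGen n (2 * p - 1) * yGen n (2 * p) * om n ^ (k - 1)) := by
  rw [ctr_om_pow (commute_om_yGen _ _).neg_right (ctr_even_om_mul hp), mul_smul_comm, ← mul_assoc,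
    mul_neg, ← yGen_mul_yGen_swap]

theorem cop_comp_cop_odd_om_pow {n p : ℕ} (hp : p ∈ Finset.Icc 1 (n - 1)) (k : ℕ) :
    cop n (4 * p) (cop n (4 * p + 1) (om n ^ k)) =
      Complex.I • (om n ^ k -
        (2 * k : ℂ) • (yGen n (2 * p - 1) * yGen n (2 * p) * om n ^ (k - 1))) := by
  have hp' := Finset.mem_Icc.mp hp
  have h : 4 * p = 2 * (2 * p - 1 + 1) := by omega
  rw [h, cop_comp_cop (by omega), yGen_mul_ctr_odd_om_pow hp, smul_smul]

theorem cop_comp_cop_even_om_pow {n p : ℕ} (hp : p ∈ Finset.Icc 1 (n - 1)) (k : ℕ) :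
    cop n (4 * p + 2) (cop n (4 * p + 3) (om n ^ k)) =
      Complex.I • (om n ^ k -
        (2 * k : ℂ) • (yGen n (2 * p - 1) * yGen n (2 * p) * om n ^ (k - 1))) := by
  have hp' := Finset.mem_Icc.mp hp
  have h : 4 * p + 2 = 2 * (2 * p + 1) := by omega
  have h' : 4 * p + 3 = 2 * (2 * p + 1) + 1 := by omega
  rw [h, h', cop_comp_cop (by omega), yGen_mul_ctr_even_om_pow hp, smul_smul]

theorem natCast_smul_om_mul_om_pow (n k : ℕ) :
    (k : ℂ) • (om n * om n ^ (k - 1)) = (k : ℂ) • om n ^ k := by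
  rcases k with _ | k
  · simp
  · rw [Nat.add_sub_cancel, ← pow_succ']

/-- In the exterior-form model of the spin representation on a
`(4n-1)`-dimensional homogeneous 3-Sasakian space, the Clifford products of the invariant
two-forms `Φ₀` and `Φ₁|_H` with `ω^k` are `Φ₀·ω^k = 0` and
`(Φ₁|_H)·ω^k = 2i(2k-n+1)·ω^k`, where
`Φ₀ = ∑_{p=1}^{n-1}(c_{4p}∘c_{4p+1} - c_{4p+2}∘c_{4p+3})` and
`Φ₁|_H = -∑_{p=1}^{n-1}(c_{4p}∘c_{4p+1} + c_{4p+2}∘c_{4p+3})`. -/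
theorem clifford_product_Phi0_Phi1_omega_pow (n : ℕ) (hn : 1 ≤ n) (k : ℕ) :
    (∑ p ∈ Finset.Icc 1 (n - 1),
        (cop n (4 * p) ∘ₗ cop n (4 * p + 1) - cop n (4 * p + 2) ∘ₗ cop n (4 * p + 3)))
        (om n ^ k) = 0 ∧
    (-∑ p ∈ Finset.Icc 1 (n - 1),
        (cop n (4 * p) ∘ₗ cop n (4 * p + 1) + cop n (4 * p + 2) ∘ₗ cop n (4 * p + 3)))
        (om n ^ k) =
      (2 * Complex.I * (2 * (k : ℂ) - (n : ℂ) + 1)) • om n ^ k := by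
  constructor
  · rw [LinearMap.sum_apply]
    refine Finset.sum_eq_zero fun p hp => ?_
    rw [LinearMap.sub_apply, LinearMap.comp_apply, LinearMap.comp_apply,
      cop_comp_cop_odd_om_pow hp, cop_comp_cop_even_om_pow hp, sub_self]
  · have hsum : ∀ p ∈ Finset.Icc 1 (n - 1),
        (cop n (4 * p) ∘ₗ cop n (4 * p + 1) + cop n (4 * p + 2) ∘ₗ cop n (4 * p + 3))
          (om n ^ k) =
        (2 * Complex.I) • om n ^ k -
          (4 * Complex.I * k) • (yGen n (2 * p - 1) * yGen n (2 * p) * om n ^ (k - 1)) := by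
      intro p hp
      rw [LinearMap.add_apply, LinearMap.comp_apply, LinearMap.comp_apply,
        cop_comp_cop_odd_om_pow hp, cop_comp_cop_even_om_pow hp]
      module
    rw [LinearMap.neg_apply, LinearMap.sum_apply, Finset.sum_congr rfl hsum,
      Finset.sum_sub_distrib, Finset.sum_const, ← Finset.smul_sum, ← Finset.sum_mul, ← om,
      mul_smul (4 * Complex.I),
      natCast_smul_om_mul_om_pow, Nat.card_Icc, Nat.add_sub_cancel,
      ← Nat.cast_smul_eq_nsmul ℂ, Nat.cast_sub hn]
    push_cast
    module
end
end

section
/- Fix n ≥ 1 and work in the exterior-form model Σ := ⋀•(ℂ^{2n−1}) with ω := Σ_{p=1}^{n−1} y_{2p}∧y_{2p+1} and Σ_inv := span_ℂ{ ω^k, y₁∧ω^k : 0 ≤ k ≤ n−1 }. Then for every ψ ∈ Σ_inv and every even (cyclic) permutation (i,j,k) of (1,2,3), one has c_j( c_k( ψ ) ) = c_i( ψ ). (This expresses that all elements of Σ_inv satisfy the Riemannian Killing spinor equation with Killing number 1/2 in the three vertical (Reeb) directions of a homogeneous 3-Sasakian space: the spinorial Levi-Civita Nomizu map satisfies Λ̃^g(ξ_i)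 = (1/2)ξ_j·ξ_k, so the equation Λ̃^g(ξ_i)·ψ = (1/2)ξ_i·ψ becomes ξ_j·ξ_k·ψ = ξ_i·ψ.) -/
noncomputable section

theorem involute_yGen (n j : ℕ) : CliffordAlgebra.involute (yGen n j) = -yGen n j := by
  unfold yGen
  split_ifs
  · exact CliffordAlgebra.involute_ι _
  · simp

theorem involute_om (n : ℕ) : CliffordAlgebra.involute (om n) = om n := by
  simp only [om, map_sum, map_mul, involute_yGen, neg_mul_neg]

theorem ctr_yGen_mul_self {n j : ℕ} (hj : j < 2 * n - 1) (x : SpinorModel n) :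
    ctr n j (yGen n j * x) = x - yGen n j * ctr n j x := by
  simp only [ctr, yGen, dif_pos hj]
  refine (CliffordAlgebra.contractLeft_ι_mul _ _ _).trans ?_
  simp [ExteriorAlgebra.ι]

theorem ctr_yGen_mul_of_ne {n i j : ℕ} (hij : i ≠ j) (x : SpinorModel n) :
    ctr n i (yGen n j * x) = -(yGen n j * ctr n i x) := by
  unfold ctr yGen
  split_ifs with hi hj
  · refine (CliffordAlgebra.contractLeft_ι_mul _ _ _).trans ?_
    have h : (Pi.single (⟨j, hj⟩ : Fin (2 * n - 1)) (1 : ℂ) : ModelV n) ⟨i, hi⟩ = 0 :=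
      Pi.single_eq_of_ne (by simpa using hij) _
    simp [ExteriorAlgebra.ι, h]
  all_goals simp

theorem ctr_zero_om_mul (n : ℕ) (x : SpinorModel n) : ctr n 0 (om n * x) = om n * ctr n 0 x := by
  simp only [om, Finset.sum_mul, map_sum]
  refine Finset.sum_congr rfl fun p hp => ?_
  have hp := (Finset.mem_Icc.mp hp).1
  rw [mul_assoc, ctr_yGen_mul_of_ne (by omega), ctr_yGen_mul_of_ne (by omega), mul_neg, neg_neg,
    mul_assoc]

theorem ctr_zero_om_pow (n k : ℕ) : ctr n 0 (om n ^ k) = 0 := by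
  induction k with
  | zero =>
    rw [pow_zero]
    unfold ctr
    split_ifs
    · exact CliffordAlgebra.contractLeft_one _ _
    · simp
  | succ k ih => rw [pow_succ', ctr_zero_om_mul, ih, mul_zero]

theorem yGen_mul_yGen_mul (n j : ℕ) (x : SpinorModel n) : yGen n j * (yGen n j * x) = 0 := by
  rw [← mul_assoc]
  unfold yGen
  split_ifs <;> simp

theorem cop_one_apply (n : ℕ) (x : SpinorModel n) :
    cop n 1 x = Complex.I • CliffordAlgebra.involute x := rfl

theorem cop_two_apply (n : ℕ) (x : SpinorModel n) :
    cop n 2 x = Complex.I • (ctr n 0 x + yGen n 0 * x) := rfl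

theorem cop_three_apply (n : ℕ) (x : SpinorModel n) :
    cop n 3 x = yGen n 0 * x - ctr n 0 x := rfl

/-- Every invariant spinor `ψ ∈ Σ_inv = span_ℂ{ω^k, y₁∧ω^k}` satisfies
`c_j(c_k(ψ)) = c_i(ψ)` for every even (cyclic) permutation `(i,j,k)` of `(1,2,3)`, i.e. the
Killing equation in the three vertical (Reeb) directions of a homogeneous 3-Sasakian space. -/
theorem invariant_spinor_vertical_killing (n : ℕ) (hn : 1 ≤ n)
    (ψ : SpinorModel n) (hψ : ψ ∈ Sinv n) :
    cop n 2 (cop n 3 ψ) = cop n 1 ψ ∧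
    cop n 3 (cop n 1 ψ) = cop n 2 ψ ∧
    cop n 1 (cop n 2 ψ) = cop n 3 ψ := by
  have h0 : 0 < 2 * n - 1 := by omega
  induction hψ using Submodule.span_induction with
  | mem x hx =>
    obtain ⟨k, -, rfl | rfl⟩ := hx <;>
    · refine ⟨?_, ?_, ?_⟩ <;>
      simp [cop_one_apply, cop_two_apply, cop_three_apply, involute_yGen, involute_om,
        ctr_yGen_mul_self h0, ctr_zero_om_pow, yGen_mul_yGen_mul, smul_smul]
  | zero => simp
  | add x y _ _ hx hy => simp only [map_add, hx, hy, and_self]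
  | smul a x _ hx => simp only [map_smul, hx, and_self]
end
end

section
/- Let m ≥ 1 and let Sp(2m, ℂ) act on ℂ^{2m} by its standard representation, with induced action on the exterior powers ⋀^k ℂ^{2m}. Let ω̃ := Σ_{i=1}^{m} e_i ∧ e_{m+i} ∈ ⋀² ℂ^{2m}, where e₁, …, e_{2m} is the standard basis. Then for every k ≥ 0, the subspace of Sp(2m, ℂ)-invariant elements of ⋀^k ℂ^{2m} equals ℂ·ω̃^{k/2} (which is one-dimensional) if k is even and 0 ≤ k ≤ 2m, and equals {0} if k is odd. In particular, the algebra of Sp(2m, ℂ)-invariant elements of the full exterior algebra ⋀• ℂ^{2m} is generated by the single 2-form ω̃. -/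
noncomputable section

/-- `ℂ^{2m}`, with the basis indexed by `Fin m ⊕ Fin m` (so `e_i = inl i` and
`e_{m+i} = inr i`). -/
abbrev Cn2 (m : ℕ) : Type := (Fin m ⊕ Fin m) → ℂ

/-- The matrix `J` of the standard symplectic form
`Ω(x,y) = ∑_{i=1}^m (x_i y_{m+i} - x_{m+i} y_i)`, i.e. `Ω(x,y) = xᵀ J y`. -/
def Jstd (m : ℕ) : Matrix (Fin m ⊕ Fin m) (Fin m ⊕ Fin m) ℂ :=
  Matrix.fromBlocks 0 1 (-1) 0

/-- Membership in the symplectic group `Sp(2m, ℂ) = {g : gᵀ J g = J}`. -/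
def IsSymp (m : ℕ) (g : Matrix (Fin m ⊕ Fin m) (Fin m ⊕ Fin m) ℂ) : Prop :=
  g.transpose * Jstd m * g = Jstd m

/-- The algebra automorphism of `⋀• ℂ^{2m}` induced by a matrix `g`. -/
def extMap (m : ℕ) (g : Matrix (Fin m ⊕ Fin m) (Fin m ⊕ Fin m) ℂ) :
    ExteriorAlgebra ℂ (Cn2 m) →ₐ[ℂ] ExteriorAlgebra ℂ (Cn2 m) :=
  ExteriorAlgebra.map g.mulVecLin

/-- The subalgebra of `Sp(2m,ℂ)`-invariant elements of the exterior algebra `⋀• ℂ^{2m}`. -/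
def sympInvAlg (m : ℕ) : Subalgebra ℂ (ExteriorAlgebra ℂ (Cn2 m)) where
  carrier := {x | ∀ g, IsSymp m g → extMap m g x = x}
  mul_mem' := fun hx hy => fun g hg => by rw [map_mul, hx g hg, hy g hg]
  one_mem' := fun g hg => by rw [map_one]
  add_mem' := fun hx hy => fun g hg => by rw [map_add, hx g hg, hy g hg]
  zero_mem' := fun g hg => by rw [map_zero]
  algebraMap_mem' := fun r => fun g hg => by rw [AlgHom.commutes]

/-- The invariant symplectic `2`-form `ω̃ = ∑_{i=1}^m e_i ∧ e_{m+i} ∈ ⋀² ℂ^{2m}`. -/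
def omTilde (m : ℕ) : ExteriorAlgebra ℂ (Cn2 m) :=
  ∑ i : Fin m,
    ExteriorAlgebra.ι ℂ (Pi.single (Sum.inl i) (1 : ℂ)) *
      ExteriorAlgebra.ι ℂ (Pi.single (Sum.inr i) (1 : ℂ))

/-- The generator of `⋀• ℂ^{2m}` given by the standard basis vector with index `a`. -/
def extGen (m : ℕ) (a : Fin m ⊕ Fin m) : ExteriorAlgebra ℂ (Cn2 m) :=
  ExteriorAlgebra.ι ℂ (Pi.single a (1 : ℂ))

/-- The product `e_i ∧ e_{m+i}`. -/
def pairForm (m : ℕ) (i : Fin m) : ExteriorAlgebra ℂ (Cn2 m) :=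
  extGen m (Sum.inl i) * extGen m (Sum.inr i)

/-- The monomial in the generators `extGen` indexed by a list. -/
def extMonomial (m : ℕ) (l : List (Fin m ⊕ Fin m)) : ExteriorAlgebra ℂ (Cn2 m) :=
  (l.map (extGen m)).prod

/-- The product of the forms `e_i ∧ e_{m+i}` over a list of indices. -/
def pairMonomial (m : ℕ) (l : List (Fin m)) : ExteriorAlgebra ℂ (Cn2 m) :=
  (l.map (pairForm m)).prod

variable {m : ℕ}

lemma omTilde_eq_sum : omTilde m = ∑ i, pairForm m i := rfl

@[simp]
lemma extMonomial_nil : extMonomial m [] = 1 := rfl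

@[simp]
lemma extMonomial_cons (a : Fin m ⊕ Fin m) (l : List (Fin m ⊕ Fin m)) :
    extMonomial m (a :: l) = extGen m a * extMonomial m l := by
  simp [extMonomial]

@[simp]
lemma pairMonomial_nil : pairMonomial m [] = 1 := rfl

@[simp]
lemma pairMonomial_cons (i : Fin m) (l : List (Fin m)) :
    pairMonomial m (i :: l) = pairForm m i * pairMonomial m l := by
  simp [pairMonomial]

lemma extGen_mul_self (a : Fin m ⊕ Fin m) : extGen m a * extGen m a = 0 :=
  ExteriorAlgebra.ι_sq_zero _

lemma extGen_mul_comm (a b : Fin m ⊕ Fin m) :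
    extGen m a * extGen m b = -(extGen m b * extGen m a) :=
  eq_neg_of_add_eq_zero_left (ExteriorAlgebra.ι_add_mul_swap _ _)

lemma pairForm_commute_extGen (i : Fin m) (a : Fin m ⊕ Fin m) :
    pairForm m i * extGen m a = extGen m a * pairForm m i := by
  rw [pairForm, mul_assoc, extGen_mul_comm (Sum.inr i) a, mul_neg, ← mul_assoc,
    extGen_mul_comm (Sum.inl i) a, neg_mul, neg_neg, mul_assoc]

lemma pairForm_commute (i j : Fin m) : Commute (pairForm m i) (pairForm m j) := by
  rw [Commute, SemiconjBy]
  conv_lhs => rw [pairForm.eq_def m j]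
  conv_rhs => rw [pairForm.eq_def m j]
  rw [← mul_assoc, pairForm_commute_extGen, mul_assoc, pairForm_commute_extGen, mul_assoc]

lemma pairForm_mul_self (i : Fin m) : pairForm m i * pairForm m i = 0 := by
  conv_lhs => rw [pairForm.eq_def m i]
  rw [mul_assoc, ← pairForm.eq_def, ← pairForm_commute_extGen, pairForm, mul_assoc,
    extGen_mul_self, mul_zero, mul_zero]

lemma pairForm_mul_pairMonomial_of_mem {i : Fin m} {l : List (Fin m)} (h : i ∈ l) :
    pairForm m i * pairMonomial m l = 0 := by
  induction l with
  | nil => simp at h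
  | cons j l ih =>
    rw [pairMonomial_cons, ← mul_assoc]
    rcases List.mem_cons.1 h with rfl | h
    · rw [pairForm_mul_self, zero_mul]
    · rw [(pairForm_commute i j).eq, mul_assoc, ih h, mul_zero]

lemma extGen_mul_extMonomial_of_mem {a : Fin m ⊕ Fin m} {l : List (Fin m ⊕ Fin m)}
    (h : a ∈ l) : extGen m a * extMonomial m l = 0 := by
  induction l with
  | nil => simp at h
  | cons b l ih =>
    rw [extMonomial_cons, ← mul_assoc]
    rcases List.mem_cons.1 h with rfl | h
    · rw [extGen_mul_self, zero_mul]
    · rw [extGen_mul_comm, neg_mul, mul_assoc, ih h, mul_zero, neg_zero]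

lemma exists_extMonomial_eq_smul_of_perm {l l' : List (Fin m ⊕ Fin m)} (h : l.Perm l') :
    ∃ c : ℂ, extMonomial m l = c • extMonomial m l' := by
  induction h with
  | nil => exact ⟨1, by simp⟩
  | cons a _ ih =>
    obtain ⟨c, hc⟩ := ih
    exact ⟨c, by simp [hc]⟩
  | swap a b l =>
    refine ⟨-1, ?_⟩
    simp only [extMonomial_cons, ← mul_assoc]
    rw [extGen_mul_comm b a]
    simp
  | trans _ _ ih ih' =>
    obtain ⟨c, hc⟩ := ih
    obtain ⟨d, hd⟩ := ih'
    exact ⟨c * d, by rw [hc, hd, smul_smul]⟩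

lemma extMonomial_flatMap (l : List (Fin m)) :
    extMonomial m (l.flatMap fun i => [Sum.inl i, Sum.inr i]) = pairMonomial m l := by
  induction l with
  | nil => rfl
  | cons i l ih => simp [ih, pairForm, mul_assoc]

lemma exists_extMonomial_eq_smul_pairMonomial {l : List (Fin m ⊕ Fin m)} (hl : l.Nodup)
    (h : ∀ i, Sum.inl i ∈ l ↔ Sum.inr i ∈ l) :
    ∃ (c : ℂ) (l' : List (Fin m)), l'.Nodup ∧ extMonomial m l = c • pairMonomial m l' := by
  classical
  let l' := (Finset.univ.filter fun i : Fin m => Sum.inl i ∈ l).toList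
  have hl' : l'.Nodup := Finset.nodup_toList _
  have hmem : ∀ i, i ∈ l' ↔ Sum.inl i ∈ l := by simp [l']
  have hnd : (l'.flatMap fun i => [(Sum.inl i : Fin m ⊕ Fin m), Sum.inr i]).Nodup := by
    rw [List.nodup_flatMap]
    refine ⟨by simp, hl'.imp ?_⟩
    intro i j hij
    simp [Function.onFun, hij.symm]
  have hperm : l.Perm (l'.flatMap fun i => [(Sum.inl i : Fin m ⊕ Fin m), Sum.inr i]) := by
    rw [List.perm_ext_iff_of_nodup hl hnd]
    rintro (i | i)
    · simp [hmem]
    · simp [hmem, h]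
  obtain ⟨c, hc⟩ := exists_extMonomial_eq_smul_of_perm hperm
  exact ⟨c, l', hl', by rw [hc, extMonomial_flatMap]⟩

lemma ι_eq_sum_extGen (v : Cn2 m) :
    ExteriorAlgebra.ι ℂ v = ∑ a, v a • extGen m a := by
  simp only [extGen, ← map_smul, ← map_sum]
  congr 1
  exact pi_eq_sum_univ' v

lemma span_extMonomial_nodup :
    Submodule.span ℂ (extMonomial m '' {l | l.Nodup}) = ⊤ := by
  rw [Submodule.eq_top_iff']
  intro x
  induction x using CliffordAlgebra.left_induction with
  | algebraMap r =>
    rw [Algebra.algebraMap_eq_smul_one]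
    exact Submodule.smul_mem _ _ (Submodule.subset_span ⟨[], List.nodup_nil, rfl⟩)
  | add x y hx hy => exact Submodule.add_mem _ hx hy
  | ι_mul x v hx =>
    induction hx using Submodule.span_induction with
    | mem y hy =>
      obtain ⟨l, hl, rfl⟩ := hy
      change ExteriorAlgebra.ι ℂ v * _ ∈ _
      rw [ι_eq_sum_extGen, Finset.sum_mul]
      refine Submodule.sum_mem _ fun a _ => ?_
      rw [smul_mul_assoc]
      refine Submodule.smul_mem _ _ ?_
      by_cases ha : a ∈ l
      · rw [extGen_mul_extMonomial_of_mem ha]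
        exact Submodule.zero_mem _
      · exact Submodule.subset_span ⟨a :: l, List.nodup_cons.2 ⟨ha, hl⟩, by simp⟩
    | zero => simp
    | add y z _ _ hy hz => rw [mul_add]; exact Submodule.add_mem _ hy hz
    | smul c y _ hy => rw [mul_smul_comm]; exact Submodule.smul_mem _ _ hy

lemma isSymp_iff (g : Matrix (Fin m ⊕ Fin m) (Fin m ⊕ Fin m) ℂ) :
    IsSymp m g ↔ g ∈ Matrix.symplecticGroup (Fin m) ℂ := by
  have hJ : Jstd m = -Matrix.J (Fin m) ℂ := by
    simp [Jstd, Matrix.J, Matrix.fromBlocks_neg]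
  simp [SymplecticGroup.mem_iff', IsSymp, hJ]

lemma extMap_extGen (g : Matrix (Fin m ⊕ Fin m) (Fin m ⊕ Fin m) ℂ) (a : Fin m ⊕ Fin m) :
    extMap m g (extGen m a) = ∑ b, g b a • extGen m b := by
  rw [extMap, extGen, ExteriorAlgebra.map_apply_ι, Matrix.mulVecLin_apply,
    Matrix.mulVec_single_one, ι_eq_sum_extGen]
  rfl

/-- The element `∑ M_{ab} e_a ∧ e_b` attached to a matrix `M`. -/
def matrixForm (M : Matrix (Fin m ⊕ Fin m) (Fin m ⊕ Fin m) ℂ) :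
    ExteriorAlgebra ℂ (Cn2 m) :=
  ∑ a, ∑ b, M a b • (extGen m a * extGen m b)

lemma matrixForm_J : matrixForm (Matrix.J (Fin m) ℂ) = (-2 : ℂ) • omTilde m := by
  have h : ∀ i : Fin m, extGen m (Sum.inr i) * extGen m (Sum.inl i) = -pairForm m i :=
    fun i => extGen_mul_comm _ _
  simp [matrixForm, Matrix.J, Matrix.one_apply, omTilde_eq_sum, h, ← pairForm.eq_def,
    two_smul]

lemma extMap_matrixForm (g M : Matrix (Fin m ⊕ Fin m) (Fin m ⊕ Fin m) ℂ) :
    extMap m g (matrixForm M) = matrixForm (g * M * g.transpose) := by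
  have hl : ∀ a b, M a b • (extMap m g (extGen m a) * extMap m g (extGen m b)) =
      ∑ c, ∑ d, (g c a * M a b * g d b) • (extGen m c * extGen m d) := by
    intro a b
    simp only [extMap_extGen, Finset.sum_mul_sum, Finset.smul_sum, smul_mul_smul_comm, smul_smul]
    refine Finset.sum_congr rfl fun c _ => Finset.sum_congr rfl fun d _ => ?_
    congr 1
    ring
  simp only [matrixForm, map_sum, map_smul, map_mul, hl, Matrix.mul_apply, Finset.sum_smul,
    Finset.sum_mul, Matrix.transpose_apply]
  rw [Finset.sum_comm_cycle]
  refine Finset.sum_congr rfl fun c _ => ?_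
  rw [Finset.sum_comm_cycle]
  exact Finset.sum_congr rfl fun d _ => Finset.sum_comm

lemma extMap_omTilde {g : Matrix (Fin m ⊕ Fin m) (Fin m ⊕ Fin m) ℂ} (hg : IsSymp m g) :
    extMap m g (omTilde m) = omTilde m := by
  have h := extMap_matrixForm g (Matrix.J (Fin m) ℂ)
  rw [SymplecticGroup.mem_iff.1 ((isSymp_iff g).1 hg), matrixForm_J, map_smul] at h
  exact smul_right_injective _ (by norm_num : (-2 : ℂ) ≠ 0) h

/-- The scaling factors of the torus element acting by `2` on `e_i` and by `2⁻¹` on `e_{m+i}`. -/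
def torusWeight (i : Fin m) : Fin m ⊕ Fin m → ℂ :=
  Sum.elim (Function.update 1 i 2) (Function.update 1 i 2⁻¹)

lemma isSymp_diagonal_torusWeight (i : Fin m) : IsSymp m (Matrix.diagonal (torusWeight i)) := by
  rw [IsSymp, Matrix.diagonal_transpose]
  ext (a | a) (b | b)
  all_goals
    simp only [Matrix.mul_diagonal, Matrix.diagonal_mul, Jstd, Matrix.fromBlocks_apply₁₁,
      Matrix.fromBlocks_apply₁₂, Matrix.fromBlocks_apply₂₁, Matrix.fromBlocks_apply₂₂,
      torusWeight, Sum.elim_inl, Sum.elim_inr, Matrix.zero_apply, Matrix.neg_apply,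
      Matrix.one_apply, Function.update_apply, Pi.one_apply]
    split_ifs <;> simp_all

lemma extMap_diagonal_extMonomial (d : Fin m ⊕ Fin m → ℂ) (l : List (Fin m ⊕ Fin m)) :
    extMap m (Matrix.diagonal d) (extMonomial m l) = (l.map d).prod • extMonomial m l := by
  induction l with
  | nil => simp
  | cons a l ih =>
    have h : extMap m (Matrix.diagonal d) (extGen m a) = d a • extGen m a := by
      rw [extMap_extGen, Finset.sum_eq_single a]
      · simp
      · intro b _ hb
        simp [Matrix.diagonal_apply_ne _ hb]
      · simp
    simp [ih, h, smul_smul, mul_comm]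

open Classical in
lemma prod_map_torusWeight (i : Fin m) {l : List (Fin m ⊕ Fin m)} (hl : l.Nodup) :
    (l.map (torusWeight i)).prod =
      (if (Sum.inl i : Fin m ⊕ Fin m) ∈ l then (2 : ℂ) else 1) *
        (if (Sum.inr i : Fin m ⊕ Fin m) ∈ l then (2 : ℂ)⁻¹ else 1) := by
  induction l with
  | nil => simp
  | cons a l ih =>
    obtain ⟨ha, hl⟩ := List.nodup_cons.1 hl
    rw [List.map_cons, List.prod_cons, ih hl]
    rcases a with j | j
    all_goals
      by_cases hj : i = j
      · subst hj
        simp [torusWeight, ha]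
      · simp [torusWeight, hj, Function.update_of_ne (Ne.symm hj)]

lemma mem_span_extMonomial_of_invariant {x : ExteriorAlgebra ℂ (Cn2 m)}
    (hx : x ∈ sympInvAlg m) (s : Finset (Fin m)) :
    x ∈ Submodule.span ℂ
      (extMonomial m '' {l | l.Nodup ∧ ∀ i ∈ s, Sum.inl i ∈ l ↔ Sum.inr i ∈ l}) := by
  classical
  induction s using Finset.induction_on with
  | empty => simp [span_extMonomial_nodup]
  | insert i s _ ih =>
    let T := (extMap m (Matrix.diagonal (torusWeight i))).toLinearMap
    let P := (5 : ℂ) • T - (2 : ℂ) • (T ∘ₗ T) - (2 : ℂ) • LinearMap.id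
    have hT : T x = x := hx _ (isSymp_diagonal_torusWeight i)
    have hP : P x = x := by
      simp only [P, LinearMap.sub_apply, LinearMap.smul_apply, LinearMap.comp_apply, hT,
        LinearMap.id_apply, ← sub_smul]
      norm_num
    rw [← hP]
    suffices h : Submodule.map P (Submodule.span ℂ
        (extMonomial m '' {l | l.Nodup ∧ ∀ i ∈ s, Sum.inl i ∈ l ↔ Sum.inr i ∈ l})) ≤ _ from
      h (Submodule.mem_map_of_mem ih)
    rw [Submodule.map_span_le]
    rintro _ ⟨l, ⟨hl, hs⟩, rfl⟩
    have hTl : T (extMonomial m l) = _ := extMap_diagonal_extMonomial _ _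
    rw [prod_map_torusWeight i hl] at hTl
    by_cases h : Sum.inl i ∈ l ↔ Sum.inr i ∈ l
    · have hPl : P (extMonomial m l) = extMonomial m l := by
        have hTl' : T (extMonomial m l) = extMonomial m l := by
          rw [hTl]
          by_cases hr : Sum.inr i ∈ l <;> simp [h, hr]
        simp only [P, LinearMap.sub_apply, LinearMap.smul_apply, LinearMap.comp_apply, hTl',
          LinearMap.id_apply, ← sub_smul]
        norm_num
      rw [hPl]
      exact Submodule.subset_span ⟨l, ⟨hl, by simpa [h] using hs⟩, rfl⟩
    · have hPl : P (extMonomial m l) = 0 := by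
        simp only [P, LinearMap.sub_apply, LinearMap.smul_apply, LinearMap.comp_apply, hTl,
          LinearMap.id_apply, ← sub_smul, map_smul, smul_smul]
        by_cases hr : Sum.inr i ∈ l <;> by_cases hl : Sum.inl i ∈ l <;>
          simp only [hr, hl, not_true, if_true, if_false] at h ⊢ <;> norm_num
      rw [hPl]
      exact Submodule.zero_mem _

lemma mem_span_pairMonomial_of_invariant {x : ExteriorAlgebra ℂ (Cn2 m)}
    (hx : x ∈ sympInvAlg m) :
    x ∈ Submodule.span ℂ (pairMonomial m '' {l | l.Nodup}) := by
  refine Submodule.span_le.2 ?_ (mem_span_extMonomial_of_invariant hx Finset.univ)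
  rintro _ ⟨l, ⟨hl, h⟩, rfl⟩
  obtain ⟨c, l', hl', hc⟩ :=
    exists_extMonomial_eq_smul_pairMonomial hl fun i => h i (Finset.mem_univ i)
  rw [hc]
  exact Submodule.smul_mem _ _ (Submodule.subset_span ⟨l', hl', rfl⟩)

/-- The matrix of the simultaneous permutation of the `e_i` and of the `e_{m+i}`. -/
def pairPermMatrix (σ : Equiv.Perm (Fin m)) : Matrix (Fin m ⊕ Fin m) (Fin m ⊕ Fin m) ℂ :=
  Matrix.of fun b a => if b = Sum.map σ σ a then 1 else 0

lemma isSymp_pairPermMatrix (σ : Equiv.Perm (Fin m)) : IsSymp m (pairPermMatrix σ) := by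
  rw [IsSymp]
  ext (a | a) (b | b)
  all_goals
    simp [Matrix.mul_apply, pairPermMatrix, Jstd, Matrix.one_apply]

/-- The action of a permutation of the indices `1, …, m` on the exterior algebra. -/
def permAct (σ : Equiv.Perm (Fin m)) :
    ExteriorAlgebra ℂ (Cn2 m) →ₐ[ℂ] ExteriorAlgebra ℂ (Cn2 m) :=
  extMap m (pairPermMatrix σ)

lemma permAct_extGen (σ : Equiv.Perm (Fin m)) (a : Fin m ⊕ Fin m) :
    permAct σ (extGen m a) = extGen m (Sum.map σ σ a) := by
  simp only [permAct, extMap_extGen, pairPermMatrix, Matrix.of_apply, ite_smul, one_smul,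
    zero_smul, Finset.sum_ite_eq', Finset.mem_univ, if_true]

lemma permAct_pairForm (σ : Equiv.Perm (Fin m)) (i : Fin m) :
    permAct σ (pairForm m i) = pairForm m (σ i) := by
  simp [pairForm, permAct_extGen]

lemma permAct_pairMonomial (σ : Equiv.Perm (Fin m)) (l : List (Fin m)) :
    permAct σ (pairMonomial m l) = pairMonomial m (l.map σ) := by
  induction l with
  | nil => simp
  | cons i l ih => simp [ih, permAct_pairForm]

/-- The sum of all translates of an element under the permutations of the indices. -/
def permSum : ExteriorAlgebra ℂ (Cn2 m) →ₗ[ℂ] ExteriorAlgebra ℂ (Cn2 m) :=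
  ∑ σ : Equiv.Perm (Fin m), (permAct σ).toLinearMap

lemma permSum_apply (x : ExteriorAlgebra ℂ (Cn2 m)) :
    permSum x = ∑ σ : Equiv.Perm (Fin m), permAct σ x := by
  simp [permSum]

lemma permSum_pairMonomial_map (τ : Equiv.Perm (Fin m)) (l : List (Fin m)) :
    permSum (pairMonomial m (l.map τ)) = permSum (pairMonomial m l) := by
  simp only [permSum_apply, permAct_pairMonomial, List.map_map]
  exact Fintype.sum_equiv (Equiv.mulRight τ) _ _ fun σ => rfl

lemma permAct_omTilde (σ : Equiv.Perm (Fin m)) : permAct σ (omTilde m) = omTilde m :=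
  extMap_omTilde (isSymp_pairPermMatrix σ)

lemma permSum_pairMonomial_cons_eq {l : List (Fin m)} {i j : Fin m} (hi : i ∉ l) (hj : j ∉ l) :
    permSum (pairMonomial m (i :: l)) = permSum (pairMonomial m (j :: l)) := by
  rw [← permSum_pairMonomial_map (Equiv.swap i j) (i :: l), List.map_cons,
    Equiv.swap_apply_left]
  congr 3
  conv_rhs => rw [← List.map_id l]
  refine List.map_congr_left fun a ha => ?_
  exact Equiv.swap_apply_of_ne_of_ne (fun h => hi (h ▸ ha)) fun h => hj (h ▸ ha)

lemma omTilde_mul_permSum (x : ExteriorAlgebra ℂ (Cn2 m)) :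
    omTilde m * permSum x = permSum (omTilde m * x) := by
  simp [permSum_apply, Finset.mul_sum, permAct_omTilde]

lemma permSum_pairMonomial_mem {l : List (Fin m)} (hl : l.Nodup) :
    permSum (pairMonomial m l) ∈ Submodule.span ℂ {omTilde m ^ l.length} := by
  classical
  induction l with
  | nil =>
    simp only [permSum_apply, pairMonomial_nil, map_one, List.length_nil, pow_zero]
    exact Submodule.sum_mem _ fun _ _ => Submodule.mem_span_singleton_self _
  | cons i l ih =>
    obtain ⟨hi, hl⟩ := List.nodup_cons.1 hl
    obtain ⟨c, hc⟩ := Submodule.mem_span_singleton.1 (ih hl)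
    have h : omTilde m * permSum (pairMonomial m l) =
        ((Finset.univ.filter fun j => j ∉ l).card : ℂ) • permSum (pairMonomial m (i :: l)) := by
      rw [omTilde_mul_permSum, omTilde_eq_sum, Finset.sum_mul, map_sum, Nat.cast_smul_eq_nsmul,
        ← Finset.sum_const, Finset.sum_filter]
      refine Finset.sum_congr rfl fun j _ => ?_
      split_ifs with hj
      · rw [pairForm_mul_pairMonomial_of_mem hj, map_zero]
      · rw [← pairMonomial_cons, permSum_pairMonomial_cons_eq hj hi]
    have hcard : ((Finset.univ.filter fun j => j ∉ l).card : ℂ) ≠ 0 := by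
      rw [Nat.cast_ne_zero, Finset.card_ne_zero]
      exact ⟨i, by simpa using hi⟩
    rw [← hc, mul_smul_comm, ← pow_succ'] at h
    rw [← inv_smul_smul₀ hcard (permSum _), ← h, smul_smul]
    exact Submodule.smul_mem _ _ (Submodule.mem_span_singleton_self _)

lemma mem_span_omTilde_pow_of_invariant {x : ExteriorAlgebra ℂ (Cn2 m)}
    (hx : x ∈ sympInvAlg m) :
    x ∈ Submodule.span ℂ (Set.range fun j : ℕ => omTilde m ^ j) := by
  have hsum : permSum x = (m.factorial : ℂ) • x := by
    have h : ∀ σ : Equiv.Perm (Fin m), permAct σ x = x := fun σ =>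
      hx _ (isSymp_pairPermMatrix σ)
    simp [permSum_apply, h, Fintype.card_perm, Nat.cast_smul_eq_nsmul]
  have hmem : permSum x ∈ Submodule.span ℂ (Set.range fun j : ℕ => omTilde m ^ j) := by
    suffices h : Submodule.map permSum (Submodule.span ℂ (pairMonomial m '' {l | l.Nodup})) ≤ _
      from h (Submodule.mem_map_of_mem (mem_span_pairMonomial_of_invariant hx))
    rw [Submodule.map_span_le]
    rintro _ ⟨l, hl, rfl⟩
    exact Submodule.span_mono (by simp) (permSum_pairMonomial_mem hl)
  rw [← inv_smul_smul₀ (Nat.cast_ne_zero.2 m.factorial_ne_zero : (m.factorial : ℂ) ≠ 0) x, ← hsum]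
  exact Submodule.smul_mem _ _ hmem

lemma contractLeft_extGen_mul (d : Module.Dual ℂ (Cn2 m)) (a : Fin m ⊕ Fin m)
    (x : ExteriorAlgebra ℂ (Cn2 m)) :
    CliffordAlgebra.contractLeft d (extGen m a * x) =
      d (Pi.single a 1) • x - extGen m a * CliffordAlgebra.contractLeft d x :=
  CliffordAlgebra.contractLeft_ι_mul d _ x

lemma contractLeft_pairForm_mul (d : Module.Dual ℂ (Cn2 m)) (i : Fin m)
    (x : ExteriorAlgebra ℂ (Cn2 m)) :
    CliffordAlgebra.contractLeft d (pairForm m i * x) =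
      d (Pi.single (Sum.inl i) 1) • (extGen m (Sum.inr i) * x) -
      d (Pi.single (Sum.inr i) 1) • (extGen m (Sum.inl i) * x) +
      pairForm m i * CliffordAlgebra.contractLeft d x := by
  rw [pairForm, mul_assoc, contractLeft_extGen_mul, contractLeft_extGen_mul, mul_sub,
    mul_smul_comm, mul_assoc]
  abel

lemma contractLeft_sum_pairForm_pow {d : Module.Dual ℂ (Cn2 m)} {s : Finset (Fin m)}
    (hl : ∀ i ∈ s, d (Pi.single (Sum.inl i) 1) = 0)
    (hr : ∀ i ∈ s, d (Pi.single (Sum.inr i) 1) = 0) (n : ℕ) :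
    CliffordAlgebra.contractLeft d ((∑ i ∈ s, pairForm m i) ^ n) = 0 := by
  induction n with
  | zero => simp
  | succ n ih =>
    rw [pow_succ', Finset.sum_mul, map_sum]
    refine Finset.sum_eq_zero fun i hi => ?_
    rw [contractLeft_pairForm_mul, hl i hi, hr i hi, ih]
    simp

lemma add_pow_of_mul_self_eq_zero {R : Type*} [Semiring R] {a b : R} (h : Commute a b)
    (ha : a * a = 0) (n : ℕ) : (a + b) ^ (n + 1) = b ^ (n + 1) + (n + 1) • (a * b ^ n) := by
  induction n with
  | zero => simp [add_comm]
  | succ n ih =>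
    have h0 : a * (a * b ^ n) = 0 := by rw [← mul_assoc, ha, zero_mul]
    have h1 : b * (a * b ^ n) = a * b ^ (n + 1) := by
      rw [← mul_assoc, ← h.eq, mul_assoc, ← pow_succ']
    rw [pow_succ', ih, add_mul, mul_add, mul_add, mul_smul_comm, mul_smul_comm, h0, h1,
      ← pow_succ', succ_nsmul _ (n + 1)]
    simp only [smul_zero, add_zero]
    abel

lemma sum_pairForm_pow_card_ne_zero (s : Finset (Fin m)) :
    (∑ i ∈ s, pairForm m i) ^ s.card ≠ 0 := by
  classical
  induction s using Finset.induction_on with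
  | empty => simp
  | insert i s hi ih =>
    intro h
    rw [Finset.card_insert_of_notMem hi, Finset.sum_insert hi, add_pow_of_mul_self_eq_zero
      (Commute.sum_right _ _ _ fun j _ => pairForm_commute i j) (pairForm_mul_self i)] at h
    have hne : ∀ j ∈ s, j ≠ i := fun j hj hji => hi (hji ▸ hj)
    have hl := congrArg (CliffordAlgebra.contractLeft
      (LinearMap.proj (Sum.inl i) : Module.Dual ℂ (Cn2 m))) h
    rw [map_add, contractLeft_sum_pairForm_pow (fun j hj => by simp [(hne j hj).symm])
      (fun j hj => by simp), map_nsmul, contractLeft_pairForm_mul,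
      contractLeft_sum_pairForm_pow (fun j hj => by simp [(hne j hj).symm])
      (fun j hj => by simp)] at hl
    have hr := congrArg (CliffordAlgebra.contractLeft
      (LinearMap.proj (Sum.inr i) : Module.Dual ℂ (Cn2 m))) hl
    simp only [LinearMap.proj_apply, Pi.single_eq_same, one_smul, ne_eq, reduceCtorEq,
      not_false_eq_true, Pi.single_eq_of_ne, zero_smul, sub_zero, mul_zero, add_zero, zero_add,
      map_nsmul, contractLeft_extGen_mul, map_zero] at hr
    rw [contractLeft_sum_pairForm_pow (fun j hj => by simp)
      (fun j hj => by simp [(hne j hj).symm]), mul_zero, sub_zero,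
      ← Nat.cast_smul_eq_nsmul ℂ] at hr
    exact ih ((smul_eq_zero.1 hr).resolve_left (Nat.cast_ne_zero.2 (Nat.succ_ne_zero _)))

lemma omTilde_pow_ne_zero {j : ℕ} (hj : j ≤ m) : omTilde m ^ j ≠ 0 := by
  intro h
  refine sum_pairForm_pow_card_ne_zero (Finset.univ : Finset (Fin m)) ?_
  rw [← omTilde_eq_sum, Finset.card_univ, Fintype.card_fin]
  exact pow_eq_zero_of_le hj h

lemma omTilde_pow_mem (j : ℕ) : omTilde m ^ j ∈ ⋀[ℂ]^(2 * j) (Cn2 m) := by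
  have h : omTilde m ∈ ⋀[ℂ]^2 (Cn2 m) := by
    refine Submodule.sum_mem _ fun i _ => ?_
    rw [ExteriorAlgebra.exteriorPower, pow_two]
    exact Submodule.mul_mem_mul ⟨_, rfl⟩ ⟨_, rfl⟩
  rw [ExteriorAlgebra.exteriorPower, pow_mul]
  exact Submodule.pow_mem_pow _ h j

lemma omTilde_mem_sympInvAlg : omTilde m ∈ sympInvAlg m := fun _ hg => extMap_omTilde hg

lemma mem_span_omTilde_pow_of_mem_exteriorPower {k : ℕ} {x : ExteriorAlgebra ℂ (Cn2 m)}
    (hx : x ∈ sympInvAlg m) (hk : x ∈ ⋀[ℂ]^k (Cn2 m)) :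
    x ∈ Submodule.span ℂ ((fun j => omTilde m ^ j) '' {j | 2 * j = k}) := by
  let p := GradedAlgebra.proj (fun i : ℕ => ⋀[ℂ]^i (Cn2 m)) k
  have hp : p x = x := by
    simp [p, GradedAlgebra.proj_apply, DirectSum.decompose_of_mem_same (fun i : ℕ => ⋀[ℂ]^i (Cn2 m)) hk]
  rw [← hp]
  suffices h : Submodule.map p (Submodule.span ℂ (Set.range fun j : ℕ => omTilde m ^ j)) ≤ _
    from h (Submodule.mem_map_of_mem (mem_span_omTilde_pow_of_invariant hx))
  rw [Submodule.map_span_le]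
  rintro _ ⟨j, rfl⟩
  by_cases hj : 2 * j = k
  · have h := omTilde_pow_mem (m := m) j
    rw [hj] at h
    simp only [p, GradedAlgebra.proj_apply]
    rw [DirectSum.decompose_of_mem_same (fun i : ℕ => ⋀[ℂ]^i (Cn2 m)) h]
    exact Submodule.subset_span ⟨j, hj, rfl⟩
  · simp only [p, GradedAlgebra.proj_apply]
    rw [DirectSum.decompose_of_mem_ne (fun i : ℕ => ⋀[ℂ]^i (Cn2 m)) (omTilde_pow_mem (m := m) j) hj]
    exact Submodule.zero_mem _

/-- For the standard action of `Sp(2m,ℂ)` on `ℂ^{2m}`: the subspace of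
invariant elements of `⋀^k ℂ^{2m}` is the (one-dimensional) line `ℂ·ω̃^{k/2}` when `k` is
even with `0 ≤ k ≤ 2m`, and is zero when `k` is odd.  In particular, the algebra of
invariant elements of `⋀• ℂ^{2m}` is generated by the single 2-form `ω̃`. -/
theorem symplectic_invariants_exterior_power (m : ℕ) (hm : 1 ≤ m) :
    (∀ k : ℕ, Even k → k ≤ 2 * m →
      Subalgebra.toSubmodule (sympInvAlg m) ⊓ (⋀[ℂ]^k (Cn2 m)) =
        Submodule.span ℂ {omTilde m ^ (k / 2)} ∧
      Module.finrank ℂ (Submodule.span ℂ {omTilde m ^ (k / 2)}) = 1) ∧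
    (∀ k : ℕ, ¬ Even k →
      Subalgebra.toSubmodule (sympInvAlg m) ⊓ (⋀[ℂ]^k (Cn2 m)) = ⊥) ∧
    sympInvAlg m = Algebra.adjoin ℂ {omTilde m} := by
  refine ⟨fun k hk hkm => ⟨le_antisymm ?_ ?_, ?_⟩, fun k hk => ?_, le_antisymm ?_ ?_⟩
  · rintro x ⟨hx, hxk⟩
    refine Submodule.span_mono ?_ (mem_span_omTilde_pow_of_mem_exteriorPower hx hxk)
    rintro _ ⟨j, hj, rfl⟩
    have hj' : k / 2 = j := by
      have : 2 * j = k := hj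
      omega
    simp [hj']
  · rw [Submodule.span_singleton_le_iff_mem]
    refine ⟨Subalgebra.pow_mem _ omTilde_mem_sympInvAlg _, ?_⟩
    have h := omTilde_pow_mem (m := m) (k / 2)
    rwa [Nat.two_mul_div_two_of_even hk] at h
  · exact finrank_span_singleton (omTilde_pow_ne_zero (by omega))
  · rw [eq_bot_iff]
    rintro x ⟨hx, hxk⟩
    have h := mem_span_omTilde_pow_of_mem_exteriorPower hx hxk
    have he : {j | 2 * j = k} = ∅ := by
      ext j
      simp only [Set.mem_ofPred_eq, Set.mem_empty_iff_false, iff_false]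
      rintro rfl
      exact hk (even_two_mul j)
    simpa [he] using h
  · intro x hx
    have hle : Submodule.span ℂ (Set.range fun j : ℕ => omTilde m ^ j) ≤
        Subalgebra.toSubmodule (Algebra.adjoin ℂ {omTilde m}) := by
      rw [Submodule.span_le]
      rintro _ ⟨j, rfl⟩
      exact Subalgebra.pow_mem _ (Algebra.self_mem_adjoin_singleton ℂ _) j
    exact hle (mem_span_omTilde_pow_of_invariant hx)
  · rw [Algebra.adjoin_le_iff, Set.singleton_subset_iff]
    exact omTilde_mem_sympInvAlg
end
end
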